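/- There exists u* in the closed unit ball of ℝ^k such that, for every smooth function φ : ℝ^d → ℝ satisfying φ(λ(t_l)) = 0 for every l ∈ ℕ, one has Dφ(λ(t*))[g₀(λ(t*))] + Σ_{i=1}^{k} u*_i · Dφ(λ(t*))[g_i(λ(t*))] = 0, where Dφ(x) denotes the Fréchet derivative of φ at x. -/

import Mathlib

open MeasureTheory Filter Set Topology

/-- Mean value inequality for a Lipschitz function whose derivative is bounded almost everywhere. -/
theorem LipschitzOnWith.norm_sub_le_of_ae_hasDerivAt {E : Type*} [NormedAddCommGroup E]
    [NormedSpace ℝ E] {f f' : ℝ → E} {a b C : ℝ} {K : NNReal}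
    (hf : LipschitzOnWith K f (uIcc a b))
    (hf' : ∀ᵐ x, x ∈ uIcc a b → HasDerivAt f (f' x) x ∧ ‖f' x‖ ≤ C) :
    ‖f b - f a‖ ≤ C * |b - a| := by
  obtain ⟨L, hL, hLx⟩ := exists_dual_vector'' ℝ (f b - f a)
  have hac : AbsolutelyContinuousOnInterval (fun x => L (f x)) a b :=
    (L.lipschitz.comp_lipschitzOnWith hf).absolutelyContinuousOnInterval
  have hbound : ‖∫ x in a..b, deriv (fun x => L (f x)) x‖ ≤ C * |b - a| := by
    refine intervalIntegral.norm_integral_le_of_norm_le_const_ae ?_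
    filter_upwards [hf'] with x hx hxab
    obtain ⟨hd, hC⟩ := hx (uIoc_subset_uIcc hxab)
    have hLd : HasDerivAt (fun x => L (f x)) (L (f' x)) x := L.hasFDerivAt.comp_hasDerivAt x hd
    rw [hLd.deriv]
    exact (L.le_of_opNorm_le hL _).trans (by simpa using hC)
  rw [hac.integral_deriv_eq_sub, ← map_sub, hLx] at hbound
  simpa using hbound

/-- A Lipschitz function whose almost everywhere defined derivative tends to zero at a point
is differentiable there with zero derivative. -/
theorem LipschitzOnWith.hasDerivWithinAt_zero_of_ae_hasDerivAt {E : Type*} [NormedAddCommGroup E]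
    [NormedSpace ℝ E] {f f' : ℝ → E} {r : ℝ → ℝ} {s : Set ℝ} [s.OrdConnected] {x : ℝ} {K : NNReal}
    (hx : x ∈ s) (hf : LipschitzOnWith K f s)
    (hf' : ∀ᵐ y, y ∈ s → HasDerivAt f (f' y) y ∧ ‖f' y‖ ≤ r y)
    (hr : Tendsto r (𝓝[s] x) (𝓝 0)) :
    HasDerivWithinAt f 0 s x := by
  rw [hasDerivWithinAt_iff_isLittleO, Asymptotics.isLittleO_iff]
  intro ε hε
  obtain ⟨δ, hδ, hball⟩ := Metric.mem_nhdsWithin_iff.1 (hr.eventually_lt_const hε)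
  filter_upwards [inter_mem_nhdsWithin s (Metric.ball_mem_nhds x hδ)] with y ⟨hys, hyb⟩
  have hsub : uIcc x y ⊆ s := OrdConnected.uIcc_subset ‹_› hx hys
  have hsubb : uIcc x y ⊆ Metric.ball x δ := by
    rw [Real.ball_eq_Ioo] at hyb ⊢
    exact ordConnected_Ioo.uIcc_subset ⟨by linarith, by linarith⟩ hyb
  have key := (hf.mono hsub).norm_sub_le_of_ae_hasDerivAt (f' := f') (C := ε) <| by
    filter_upwards [hf'] with z hz hzxy
    have hzr : r z < ε := hball ⟨hsubb hzxy, hsub hzxy⟩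
    exact ⟨(hz (hsub hzxy)).1, (hz (hsub hzxy)).2.trans hzr.le⟩
  simpa using key

/-- For a Lipschitz solution of `γ' = b + B u` with bounded `u` and `b`, `B` continuous at `x`,
removing the averaged control term `B x (∫ u)` leaves a function differentiable at `x`. -/
theorem LipschitzOnWith.hasDerivWithinAt_sub_integral_control {E V : Type*} [NormedAddCommGroup E]
    [NormedSpace ℝ E] [NormedAddCommGroup V] [NormedSpace ℝ V] [CompleteSpace V]
    {γ b : ℝ → E} {B : ℝ → V →L[ℝ] E} {u : ℝ → V} {p q x : ℝ} {K : NNReal}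
    (hx : x ∈ Icc p q) (hγ : LipschitzOnWith K γ (Icc p q))
    (hode : ∀ᵐ t, t ∈ Icc p q → HasDerivAt γ (b t + B t (u t)) t)
    (hb : ContinuousWithinAt b (Icc p q) x) (hB : ContinuousWithinAt B (Icc p q) x)
    (hu : IntervalIntegrable u volume p q) (hu1 : ∀ᵐ t, t ∈ Icc p q → ‖u t‖ ≤ 1) :
    HasDerivWithinAt (fun t => γ t - B x (∫ s in x..t, u s)) (b x) (Icc p q) x := by
  have hpq : uIcc p q = Icc p q := uIcc_of_le (hx.1.trans hx.2)
  have hU : LipschitzOnWith 1 (fun t => ∫ s in x..t, u s) (Icc p q) := by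
    refine LipschitzOnWith.of_dist_le_mul fun y hy z hz => ?_
    have hint : ∀ w ∈ Icc p q, IntervalIntegrable u volume x w := fun w hw =>
      hu.mono_set (by rw [hpq]; exact ordConnected_Icc.uIcc_subset hx hw)
    rw [dist_eq_norm, intervalIntegral.integral_interval_sub_left (hint y hy) (hint z hz),
      Real.dist_eq]
    refine intervalIntegral.norm_integral_le_of_norm_le_const_ae ?_
    filter_upwards [hu1] with t ht htz
    exact ht (ordConnected_Icc.uIcc_subset hz hy (uIoc_subset_uIcc htz))
  have hlin : LipschitzWith ‖b x‖₊ (fun t : ℝ => (t - x) • b x) :=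
    LipschitzWith.of_dist_le_mul fun y z => by
      rw [dist_eq_norm, ← sub_smul, norm_smul, dist_eq_norm, mul_comm]; simp
  have hBU := (B x).lipschitz.comp_lipschitzOnWith hU
  have hlip : LipschitzOnWith (K + ‖B x‖₊ * 1 + ‖b x‖₊)
      (fun t => γ t - B x (∫ s in x..t, u s) - (t - x) • b x) (Icc p q) :=
    (hγ.sub hBU).sub hlin.lipschitzOnWith
  have hzero := hlip.hasDerivWithinAt_zero_of_ae_hasDerivAt hx
    (f' := fun t => (b t - b x) + (B t - B x) (u t)) (r := fun t => ‖b t - b x‖ + ‖B t - B x‖)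
    (by
      filter_upwards [hode, hu.ae_hasDerivAt_integral, hu1] with t h1 h2 h3 ht
      constructor
      · have hd := ((h1 ht).sub ((B x).hasFDerivAt.comp_hasDerivAt t
          (h2 (hpq ▸ ht) x (hpq ▸ hx)))).sub (((hasDerivAt_id t).sub_const x).smul_const (b x))
        convert! hd using 1
        simp only [one_smul, sub_apply]
        abel
      · refine (norm_add_le _ _).trans (add_le_add_right ?_ _)
        exact ((B t - B x).le_opNorm _).trans (mul_le_of_le_one_right (norm_nonneg _) (h3 ht)))
    (by
      have h1 := (tendsto_iff_norm_sub_tendsto_zero.1 hb)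
      have h2 := (tendsto_iff_norm_sub_tendsto_zero.1 hB)
      simpa using h1.add h2)
  have hd := hzero.add
    ((((hasDerivAt_id x).sub_const x).smul_const (b x)).hasDerivWithinAt (s := Icc p q))
  convert! hd using 1
  · ext t; simp
  · simp

/-- If `φ` vanishes along `γ ∘ t` and the difference quotients of `γ` along `t` converge to `w`,
then the derivative of `φ` vanishes in the direction `w`. -/
theorem HasFDerivAt.apply_eq_zero_of_tendsto_slope {E F : Type*} [NormedAddCommGroup E]
    [NormedSpace ℝ E] [NormedAddCommGroup F] [NormedSpace ℝ F] {φ : E → F} {φ' : E →L[ℝ] F}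
    {γ : ℝ → E} {t : ℕ → ℝ} {x : ℝ} {w : E} (hφ : HasFDerivAt φ φ' (γ x))
    (hγ : Tendsto (fun n => γ (t n)) atTop (𝓝 (γ x)))
    (hw : Tendsto (fun n => slope γ x (t n)) atTop (𝓝 w)) (h0 : ∀ n, φ (γ (t n)) = 0) :
    φ' w = 0 := by
  have hx0 : φ (γ x) = 0 :=
    tendsto_nhds_unique (hφ.continuousAt.tendsto.comp hγ)
      (by simp [Function.comp_def, h0])
  have hlim := (hasFDerivWithinAt_univ.2 hφ).lim (l := atTop) (c := fun n => (t n - x)⁻¹)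
    (d := fun n => γ (t n) - γ x) (v := w) (by simpa using hγ.sub_const (γ x)) (by simp) hw
  exact tendsto_nhds_unique hlim (by simp [h0, hx0])

/-- Differentiation lemma along an extremal curve: if `γ` solves the control-affine
ODE `γ' = g₀(γ) + Σᵢ uᵢ gᵢ(γ)` and `(t l)` is a nontrivial sequence in `[0,T]`
converging to `t*`, then there exists `u*` in the closed unit ball of `ℝ^k` such that
every smooth `φ : ℝ^d → ℝ` vanishing along `γ (t l)` satisfies
`Dφ(γ(t*))[g₀(γ(t*))] + Σᵢ u*ᵢ Dφ(γ(t*))[gᵢ(γ(t*))] = 0`. -/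
theorem differentiation_lemma (d k : ℕ) (T : ℝ) (hT : 0 < T)
    (g₀ : EuclideanSpace ℝ (Fin d) → EuclideanSpace ℝ (Fin d))
    (g : Fin k → EuclideanSpace ℝ (Fin d) → EuclideanSpace ℝ (Fin d))
    (hg₀ : ContDiff ℝ (⊤ : ℕ∞) g₀) (hg : ∀ i, ContDiff ℝ (⊤ : ℕ∞) (g i))
    (u : ℝ → EuclideanSpace ℝ (Fin k)) (hu_meas : Measurable u)
    (hu_bound : ∀ᵐ t ∂(volume.restrict (Set.Icc 0 T)), ‖u t‖ ≤ 1)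
    (γ : ℝ → EuclideanSpace ℝ (Fin d))
    (hγ_lip : ∃ C : NNReal, LipschitzOnWith C γ (Set.Icc 0 T))
    (hγ_ode : ∀ᵐ t ∂(volume.restrict (Set.Icc 0 T)),
      HasDerivAt γ (g₀ (γ t) + ∑ i, u t i • g i (γ t)) t)
    (tseq : ℕ → ℝ) (htseq : ∀ l, tseq l ∈ Set.Icc 0 T)
    (tstar : ℝ) (htstar : tstar ∈ Set.Icc 0 T)
    (hconv : Tendsto tseq atTop (nhds tstar))
    (hne : ∀ l, tseq l ≠ tstar) :
    ∃ ustar : EuclideanSpace ℝ (Fin k), ‖ustar‖ ≤ 1 ∧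
      ∀ φ : EuclideanSpace ℝ (Fin d) → ℝ, ContDiff ℝ (⊤ : ℕ∞) φ →
        (∀ l, φ (γ (tseq l)) = 0) →
        fderiv ℝ φ (γ tstar) (g₀ (γ tstar))
          + ∑ i, ustar i * fderiv ℝ φ (γ tstar) (g i (γ tstar)) = 0 := by
  obtain ⟨C, hC⟩ := hγ_lip
  have hu1 : ∀ᵐ t, t ∈ Icc 0 T → ‖u t‖ ≤ 1 := (ae_restrict_iff' measurableSet_Icc).1 hu_bound
  have hode := (ae_restrict_iff' measurableSet_Icc).1 hγ_ode
  have hu : IntervalIntegrable u volume 0 T := by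
    rw [intervalIntegrable_iff_integrableOn_Icc_of_le hT.le]
    exact Measure.integrableOn_of_bounded (M := 1) (by simp) hu_meas.aestronglyMeasurable hu_bound
  have hγc : ContinuousWithinAt γ (Icc 0 T) tstar := hC.continuousOn tstar htstar
  let B : ℝ → EuclideanSpace ℝ (Fin k) →L[ℝ] EuclideanSpace ℝ (Fin d) := fun t =>
    ∑ i, (EuclideanSpace.proj i : EuclideanSpace ℝ (Fin k) →L[ℝ] ℝ).smulRight (g i (γ t))
  have hB_apply : ∀ t v, B t v = ∑ i, v i • g i (γ t) := fun t v => by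
    simp [B]
  have hBc : ContinuousWithinAt B (Icc 0 T) tstar := by
    refine tendsto_finsetSum _ fun i _ => ?_
    exact ((ContinuousLinearMap.smulRightL ℝ (EuclideanSpace ℝ (Fin k))
      (EuclideanSpace ℝ (Fin d)) (EuclideanSpace.proj i)).continuous.tendsto _).comp
      (((hg i).continuous.tendsto _).comp hγc)
  have hderiv := hC.hasDerivWithinAt_sub_integral_control (b := fun t => g₀ (γ t)) (B := B)
    htstar (by simpa only [hB_apply] using hode)
    ((hg₀.continuous.tendsto _).comp hγc) hBc hu hu1
  have hseq : Tendsto tseq atTop (𝓝[Icc 0 T \ {tstar}] tstar) :=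
    tendsto_nhdsWithin_iff.2 ⟨hconv, .of_forall fun l => ⟨htseq l, hne l⟩⟩
  have hslope := (hasDerivWithinAt_iff_tendsto_slope.1 hderiv).comp hseq
  let v : ℕ → EuclideanSpace ℝ (Fin k) := fun l =>
    (tseq l - tstar)⁻¹ • ∫ s in tstar..tseq l, u s
  have hv : ∀ l, v l ∈ Metric.closedBall (0 : EuclideanSpace ℝ (Fin k)) 1 := fun l => by
    have hint : ‖∫ s in tstar..tseq l, u s‖ ≤ 1 * |tseq l - tstar| := by
      refine intervalIntegral.norm_integral_le_of_norm_le_const_ae ?_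
      filter_upwards [hu1] with t ht htl
      exact ht (ordConnected_Icc.uIcc_subset htstar (htseq l) (uIoc_subset_uIcc htl))
    have hpos : 0 < |tseq l - tstar| := abs_pos.2 (sub_ne_zero.2 (hne l))
    rw [mem_closedBall_zero_iff, norm_smul, norm_inv, Real.norm_eq_abs, inv_mul_le_iff₀ hpos]
    linarith
  obtain ⟨ustar, hustar, ψ, hψ, hlim⟩ :=
    (isCompact_closedBall (0 : EuclideanSpace ℝ (Fin k)) 1).tendsto_subseq hv
  refine ⟨ustar, mem_closedBall_zero_iff.1 hustar, fun φ hφ h0 => ?_⟩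
  have hw : Tendsto (fun n => slope γ tstar (tseq (ψ n))) atTop
      (𝓝 (g₀ (γ tstar) + B tstar ustar)) := by
    refine ((hslope.comp hψ.tendsto_atTop).add
      (((B tstar).continuous.tendsto _).comp hlim)).congr fun n => ?_
    simp only [Function.comp_apply, v, slope_def_module, intervalIntegral.integral_same, map_zero,
      map_smul, sub_zero, ← smul_add]
    congr 1
    abel
  have hγseq : Tendsto (fun n => γ (tseq (ψ n))) atTop (𝓝 (γ tstar)) :=
    hγc.tendsto.comp ((hseq.mono_right (nhdsWithin_mono _ sdiff_subset)).comp hψ.tendsto_atTop)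
  have hzero := (hφ.differentiable (by simp) (γ tstar)).hasFDerivAt.apply_eq_zero_of_tendsto_slope
    (t := fun n => tseq (ψ n)) hγseq hw fun n => h0 (ψ n)
  simpa only [hB_apply, map_add, map_sum, map_smul, smul_eq_mul] using hzero
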